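/- Under the FLP data, suppose additionally that ubˢ i ≥ Real.sqrt (α i) for all i and s ∈ {x, y}. Then the point defined by ĉˢ i = Lˢ / 2, d̂ˢ i j = 0, ℓ̂ˢ i = max (lbˢ i) (Real.sqrt (α i)), and ẑˢ i j = 1 / 4 (for all s ∈ {x, y}, all i, and all i ≠ j) belongs to the LP relaxation Q₂ᴸᴾ, and the infimum of the objective over Q₂ᴸᴾ equals 0. -/

import Mathlib

open Finset

/-- The weighted sum `∑_{i<j, i,j ∈ C} p i j * d i j` over pairs of indices in `C`. -/
noncomputable def pairObj {N : ℕ} (p d : Fin N → Fin N → ℝ) (C : Finset (Fin N)) : ℝ :=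
  ∑ q ∈ (C ×ˢ C).filter (fun q => q.1 < q.2), p q.1 q.2 * d q.1 q.2

/-- Membership in the restricted FLP feasible set `Q₂(C)`; `Q₂ = Q₂(Finset.univ)`. -/
def Mem2D {N : ℕ} (lbx ubx lby uby : Fin N → ℝ) (Lx Ly : ℝ) (α : Fin N → ℝ)
    (C : Finset (Fin N)) (cx cy lx ly : Fin N → ℝ)
    (dx dy zx zy : Fin N → Fin N → ℝ) : Prop :=
  (∀ i ∈ C, ∀ j ∈ C, i ≠ j → dx i j = dx j i ∧ dy i j = dy j i) ∧
  (∀ i ∈ C, ∀ j ∈ C, i ≠ j → dx i j ≥ cx i - cx j ∧ dy i j ≥ cy i - cy j) ∧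
  (∀ i ∈ C, lx i ≤ cx i ∧ cx i ≤ Lx - lx i ∧ ly i ≤ cy i ∧ cy i ≤ Ly - ly i) ∧
  (∀ i ∈ C, 4 * lx i * ly i ≥ α i) ∧
  (∀ i ∈ C, ∀ j ∈ C, i ≠ j →
    cx i + lx i ≤ cx j - lx j + Lx * (1 - zx i j) ∧
    cy i + ly i ≤ cy j - ly j + Ly * (1 - zy i j)) ∧
  (∀ i ∈ C, ∀ j ∈ C, i ≠ j → zx i j + zx j i + zy i j + zy j i = 1) ∧
  (∀ i ∈ C, lbx i ≤ lx i ∧ lx i ≤ ubx i ∧ lby i ≤ ly i ∧ ly i ≤ uby i) ∧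
  (∀ i ∈ C, ∀ j ∈ C, i ≠ j →
    zx i j ∈ ({0, 1} : Set ℝ) ∧ zy i j ∈ ({0, 1} : Set ℝ))

/-- `γ₂(C)`: the optimal (infimum) value of the FLP restricted to the components `C`. -/
noncomputable def gamma2 {N : ℕ} (lbx ubx lby uby : Fin N → ℝ) (Lx Ly : ℝ)
    (α : Fin N → ℝ) (p : Fin N → Fin N → ℝ) (C : Finset (Fin N)) : ℝ :=
  sInf {v | ∃ cx cy lx ly dx dy zx zy,
    Mem2D lbx ubx lby uby Lx Ly α C cx cy lx ly dx dy zx zy ∧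
    v = pairObj p (fun i j => dx i j + dy i j) C}

/-- Membership in the LP relaxation `Q₂ᴸᴾ` of the FLP formulation. -/
def Mem2DLP {N : ℕ} (lbx ubx lby uby : Fin N → ℝ) (Lx Ly : ℝ) (α : Fin N → ℝ)
    (cx cy lx ly : Fin N → ℝ) (dx dy zx zy : Fin N → Fin N → ℝ) : Prop :=
  (∀ i j : Fin N, i ≠ j → dx i j = dx j i ∧ dy i j = dy j i) ∧
  (∀ i j : Fin N, i ≠ j → dx i j ≥ cx i - cx j ∧ dy i j ≥ cy i - cy j) ∧
  (∀ i : Fin N, lx i ≤ cx i ∧ cx i ≤ Lx - lx i ∧ ly i ≤ cy i ∧ cy i ≤ Ly - ly i) ∧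
  (∀ i : Fin N, 4 * lx i * ly i ≥ α i) ∧
  (∀ i j : Fin N, i ≠ j →
    cx i + lx i ≤ cx j - lx j + Lx * (1 - zx i j) ∧
    cy i + ly i ≤ cy j - ly j + Ly * (1 - zy i j)) ∧
  (∀ i j : Fin N, i ≠ j → zx i j + zx j i + zy i j + zy j i = 1) ∧
  (∀ i : Fin N, lbx i ≤ lx i ∧ lx i ≤ ubx i ∧ lby i ≤ ly i ∧ ly i ≤ uby i) ∧
  (∀ i j : Fin N, i ≠ j →
    (0 ≤ zx i j ∧ zx i j ≤ 1) ∧ (0 ≤ zy i j ∧ zy i j ≤ 1))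

/-- Two distinct terms of a nonnegative sum that is at most `L / 2` add up to at most `L / 2`. -/
lemma add_le_half_of_two_mul_sum_le {ι : Type*} [Fintype ι] {u : ι → ℝ} (hu : ∀ i, 0 ≤ u i)
    {L : ℝ} (hL : 2 * ∑ i, u i ≤ L) {i j : ι} (hij : i ≠ j) : u i + u j ≤ L / 2 := by
  classical
  have h := Finset.sum_le_sum_of_subset_of_nonneg (Finset.subset_univ {i, j})
    (fun k _ _ => hu k)
  rw [Finset.sum_pair hij] at h
  linarith

/-- The weighted sum is nonnegative when weights and off-diagonal distances are. -/
lemma pairObj_nonneg {N : ℕ} {p d : Fin N → Fin N → ℝ} {C : Finset (Fin N)}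
    (hp : ∀ i j, 0 ≤ p i j) (hd : ∀ i j, i ≠ j → 0 ≤ d i j) : 0 ≤ pairObj p d C :=
  Finset.sum_nonneg fun _ hq =>
    mul_nonneg (hp _ _) (hd _ _ (Finset.mem_filter.mp hq).2.ne)

/-- A symmetric function that dominates the differences of a function is nonnegative. -/
lemma nonneg_of_symm_of_sub_le {ι : Type*} {c : ι → ℝ} {d : ι → ι → ℝ} {i j : ι}
    (hs : d i j = d j i) (hij : c i - c j ≤ d i j) (hji : c j - c i ≤ d j i) : 0 ≤ d i j := by
  linarith

/-- the continuous relaxation of the FLP formulation has optimal value zero. -/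
theorem FLP_LP_relaxation_value_zero {N : ℕ} (hN : 2 ≤ N)
    (lbx ubx lby uby : Fin N → ℝ)
    (hlbx : ∀ i, 0 < lbx i) (hbx : ∀ i, lbx i ≤ ubx i)
    (hlby : ∀ i, 0 < lby i) (hby : ∀ i, lby i ≤ uby i)
    (Lx Ly : ℝ) (hLx : Lx ≥ 2 * ∑ i, ubx i) (hLy : Ly ≥ 2 * ∑ i, uby i)
    (α : Fin N → ℝ) (hα : ∀ i, 0 < α i)
    (p : Fin N → Fin N → ℝ) (hpsym : ∀ i j, p i j = p j i)
    (hpnn : ∀ i j, 0 ≤ p i j) (hpdiag : ∀ i, p i i = 0)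
    (hub : ∀ i, ubx i ≥ Real.sqrt (α i) ∧ uby i ≥ Real.sqrt (α i)) :
    Mem2DLP lbx ubx lby uby Lx Ly α
      (fun _ => Lx / 2) (fun _ => Ly / 2)
      (fun i => max (lbx i) (Real.sqrt (α i))) (fun i => max (lby i) (Real.sqrt (α i)))
      (fun _ _ => 0) (fun _ _ => 0)
      (fun _ _ => 1 / 4) (fun _ _ => 1 / 4) ∧
    sInf {v | ∃ cx cy lx ly dx dy zx zy,
        Mem2DLP lbx ubx lby uby Lx Ly α cx cy lx ly dx dy zx zy ∧
        v = pairObj p (fun i j => dx i j + dy i j) Finset.univ} = 0 := by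
  have hx0 : ∀ i, 0 ≤ ubx i := fun i => ((hlbx i).trans_le (hbx i)).le
  have hy0 : ∀ i, 0 ≤ uby i := fun i => ((hlby i).trans_le (hby i)).le
  have hlx : ∀ i, max (lbx i) (Real.sqrt (α i)) ≤ ubx i := fun i => max_le (hbx i) (hub i).1
  have hly : ∀ i, max (lby i) (Real.sqrt (α i)) ≤ uby i := fun i => max_le (hby i) (hub i).2
  have hLx' : ∀ i, ubx i ≤ Lx / 2 := fun i => by
    linarith [Finset.single_le_sum (fun k _ => hx0 k) (Finset.mem_univ i)]
  have hLy' : ∀ i, uby i ≤ Ly / 2 := fun i => by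
    linarith [Finset.single_le_sum (fun k _ => hy0 k) (Finset.mem_univ i)]
  have hmem : Mem2DLP lbx ubx lby uby Lx Ly α
      (fun _ => Lx / 2) (fun _ => Ly / 2)
      (fun i => max (lbx i) (Real.sqrt (α i))) (fun i => max (lby i) (Real.sqrt (α i)))
      (fun _ _ => 0) (fun _ _ => 0)
      (fun _ _ => 1 / 4) (fun _ _ => 1 / 4) := by
    refine ⟨fun _ _ _ => ⟨rfl, rfl⟩, fun _ _ _ => ⟨by simp, by simp⟩, fun i => ?_, fun i => ?_,
      fun i j hij => ?_, fun _ _ _ => by norm_num,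
      fun i => ⟨le_max_left _ _, hlx i, le_max_left _ _, hly i⟩, fun _ _ _ => by norm_num⟩
    · have hx := (hlx i).trans (hLx' i)
      have hy := (hly i).trans (hLy' i)
      exact ⟨hx, by linarith, hy, by linarith⟩
    · have hs : Real.sqrt (α i) * Real.sqrt (α i) ≤
          max (lbx i) (Real.sqrt (α i)) * max (lby i) (Real.sqrt (α i)) :=
        mul_le_mul (le_max_right _ _) (le_max_right _ _) (Real.sqrt_nonneg _)
          ((Real.sqrt_nonneg _).trans (le_max_right _ _))
      rw [Real.mul_self_sqrt (hα i).le] at hs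
      linarith [hα i]
    · have hx := add_le_half_of_two_mul_sum_le hx0 hLx hij
      have hy := add_le_half_of_two_mul_sum_le hy0 hLy hij
      constructor
      · linarith [hlx i, hlx j, hx0 i, hLx' i]
      · linarith [hly i, hly j, hy0 i, hLy' i]
  refine ⟨hmem, IsLeast.csInf_eq ⟨⟨_, _, _, _, _, _, _, _, hmem, by simp [pairObj]⟩, ?_⟩⟩
  rintro v ⟨cx, cy, lx, ly, dx, dy, zx, zy, ⟨hsymm, hdist, -⟩, rfl⟩
  refine pairObj_nonneg hpnn fun i j hij => add_nonneg ?_ ?_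
  · exact nonneg_of_symm_of_sub_le (hsymm i j hij).1 (hdist i j hij).1 (hdist j i hij.symm).1
  · exact nonneg_of_symm_of_sub_le (hsymm i j hij).2 (hdist i j hij).2 (hdist j i hij.symm).2
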